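/- arXiv:2307.13917 — 2 statements merged into one kernel-verified Lean document; each statement's English description precedes it below -/
import Mathlib

section
/- Let d ≥ 1, let p ∈ ℝ^d have pairwise distinct entries (p_i ≠ p_j for all i ≠ j), and let W ∈ {0,1}^{d×d}. Let π be the unique permutation of {1,…,d} such that p_{π(1)} < p_{π(2)} < ⋯ < p_{π(d)}, let P be the permutation matrix with P_{ik} = 1 if and only if k = π⁻¹(i), and let L ∈ {0,1}^{d×d} be the strictly lower-triangular all-ones matrix (L_{ab} = 1 iff a > b). Then step(grad p) = P L Pᵀ, i.e., for all i,j: [p_i > p_j] = L_{π⁻¹(i), π⁻¹(j)}; consequently W ⊙ step(grad p) = W ⊙ (P L Pᵀ). -/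
open Matrix

/-- Theorem 3.2: for `p` with pairwise distinct entries, `step(grad p)` equals `P L Pᵀ`
where `P` is the permutation matrix sorting `p` ascendingly and `L` is the strictly
lower-triangular all-ones matrix; consequently `W ⊙ step(grad p) = W ⊙ (P L Pᵀ)`. -/
theorem step_grad_eq_perm_lower_triangular
    (d : ℕ) (hd : 1 ≤ d) (p : Fin d → ℝ)
    (hp : ∀ i j : Fin d, i ≠ j → p i ≠ p j)
    (W : Matrix (Fin d) (Fin d) ℝ) (hW : ∀ i j, W i j = 0 ∨ W i j = 1)
    (π : Equiv.Perm (Fin d)) (hπ : StrictMono fun k => p (π k))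
    (P : Matrix (Fin d) (Fin d) ℝ)
    (hP : ∀ i k, P i k = if k = π.symm i then 1 else 0)
    (Lmat : Matrix (Fin d) (Fin d) ℝ)
    (hL : ∀ a b : Fin d, Lmat a b = if (b : ℕ) < (a : ℕ) then 1 else 0)
    (S : Matrix (Fin d) (Fin d) ℝ)
    (hS : ∀ i j, S i j = if p j < p i then 1 else 0) :
    (∀ i j, S i j = Lmat (π.symm i) (π.symm j)) ∧
    S = P * Lmat * Pᵀ ∧
    (∀ i j, W i j * S i j = W i j * (P * Lmat * Pᵀ) i j) := by
  have hentry : ∀ i j, S i j = Lmat (π.symm i) (π.symm j) := by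
    intro i j
    have h := hπ.lt_iff_lt (a := π.symm j) (b := π.symm i)
    simp only [Equiv.apply_symm_apply] at h
    simp only [hS, hL, h, Fin.lt_def]
  have hmul : S = P * Lmat * Pᵀ := by
    ext i j
    simp [Matrix.mul_apply, Matrix.transpose_apply, hP, hentry]
  exact ⟨hentry, hmul, fun i j => by rw [← hmul]⟩
end

section
/- Let d ≥ 1, fix W ∈ {0,1}^{d×d}, let ρ : ℝ^d → ℝ be positive and differentiable, and let F : {0,1}^{d×d} → ℝ be positive (F(G) encodes all factors of the joint density that depend on p only through the graph G, such as p(D | Θ, G) and the graph prior term). Define U : ℝ^d → ℝ by U(p) = −log( ρ(p) · F(τ(W,p)) ). Then at every point p with pairwise distinct entries, U is differentiable and ∇U(p) = −∇ρ(p)/ρ(p) = −∇ log ρ(p); in particular, the gradient of p ↦ log F(τ(W,p)) vanishes at every such p. -/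
open Filter Topology in
/-- The strict order pattern of the entries is locally constant at a point whose entries are
pairwise distinct. -/
theorem eventually_forall_lt_iff_lt {ι : Type*} [Finite ι] {α : Type*} [LinearOrder α]
    [TopologicalSpace α] [OrderClosedTopology α] {p : ι → α}
    (hp : ∀ i j, i ≠ j → p i ≠ p j) :
    ∀ᶠ q in 𝓝 p, ∀ i j, q j < q i ↔ p j < p i := by
  simp only [eventually_all]
  intro i j
  have hlt : ∀ k l, p k < p l → ∀ᶠ q in 𝓝 p, q k < q l := fun k l h =>
    (continuous_apply k).continuousAt.eventually_lt (continuous_apply l).continuousAt h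
  rcases eq_or_ne i j with rfl | hij
  · simp
  rcases (hp i j hij).lt_or_gt with h | h
  · filter_upwards [hlt i j h] with q hq
    exact iff_of_false hq.not_gt h.not_gt
  · filter_upwards [hlt j i h] with q hq
    exact iff_of_true hq h

/-- Proposition 4.2 (p-gradient part): for `U(p) = -log(ρ(p) · F(τ(W,p)))` with a positive
differentiable prior density `ρ` and positive graph factor `F`, at every `p` with pairwise
distinct entries `U` is differentiable with gradient `-∇ρ(p)/ρ(p) = -∇ log ρ(p)`; in
particular the gradient of `p ↦ log F(τ(W,p))` vanishes there. -/
theorem grad_U_eq_neg_grad_log_prior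
    (d : ℕ) (hd : 1 ≤ d)
    (W : Matrix (Fin d) (Fin d) ℝ) (hW : ∀ i j, W i j = 0 ∨ W i j = 1)
    (ρ : (Fin d → ℝ) → ℝ) (hρdiff : Differentiable ℝ ρ) (hρpos : ∀ x, 0 < ρ x)
    (F : Matrix (Fin d) (Fin d) ℝ → ℝ) (hFpos : ∀ G, 0 < F G)
    (τf : (Fin d → ℝ) → Matrix (Fin d) (Fin d) ℝ)
    (hτ : ∀ p' i j, τf p' i j = if p' j < p' i then W i j else 0)
    (U : (Fin d → ℝ) → ℝ)
    (hU : ∀ p', U p' = -Real.log (ρ p' * F (τf p'))) :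
    ∀ p : Fin d → ℝ, (∀ i j : Fin d, i ≠ j → p i ≠ p j) →
      HasFDerivAt U (-((ρ p)⁻¹ • fderiv ℝ ρ p)) p ∧
      HasFDerivAt (fun p' => Real.log (F (τf p'))) (0 : (Fin d → ℝ) →L[ℝ] ℝ) p := by
  intro p hp
  have hτ_const : ∀ᶠ q in nhds p, τf q = τf p := by
    filter_upwards [eventually_forall_lt_iff_lt hp] with q hq
    ext i j
    simp only [hτ, hq]
  have hF : HasFDerivAt (fun p' => Real.log (F (τf p'))) (0 : (Fin d → ℝ) →L[ℝ] ℝ) p :=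
    (hasFDerivAt_const (Real.log (F (τf p))) p).congr_of_eventuallyEq
      (hτ_const.mono fun q hq => congrArg (fun G => Real.log (F G)) hq)
  refine ⟨?_, hF⟩
  have hU_eq : U = fun q => -(Real.log (ρ q) + Real.log (F (τf q))) := by
    funext q
    rw [hU, Real.log_mul (hρpos q).ne' (hFpos _).ne']
  rw [hU_eq]
  rw [← add_zero ((ρ p)⁻¹ • fderiv ℝ ρ p)]
  exact (((hρdiff p).hasFDerivAt.log (hρpos p).ne').add hF).neg
end
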